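/- Assume Z_T ≠ 0, Z_L + Z_M ≠ 0, Z_S + Z_M ≠ 0, let Z, Z_P ∈ ℂ with Z + Z_P ≠ 0, and define the force tensor Φ(r) = (Z_P/(Z+Z_P)) U(r). Fix a unit vector n ∈ ℝ³. Then the ratio of the far-field force tensor to the far-field Green's tensor converges: lim_{r→∞} (nᵀ Φ(r n) n)/(nᵀ G⁰(r n) n) = 4πa(λ+2μ) e^{−ika} (Z_P/(Z+Z_P)) (Z+Z_M)/(Z_L+Z_M). (This limit is the Faxén coefficient Λ such that the force on the sphere due to an incident longitudinal plane wave with displacement u₀ at the sphere center is F_p = Λ u₀.) -/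

import Mathlib

open Complex Matrix Filter Topology

/-- Outer product matrix `r̂ ⊗ r̂` (complexified) of the unit radial direction of `x`. -/
noncomputable def outerUnit (x : EuclideanSpace ℝ (Fin 3)) : Matrix (Fin 3) (Fin 3) ℂ :=
  Matrix.of fun i j => (((x i / ‖x‖) * (x j / ‖x‖) : ℝ) : ℂ)

/-- The displacement tensor `U(r)` of a spherical inclusion, Eq. (471) of the paper. -/
noncomputable def Udisp (a k h : ℝ) (Z ZM ZL ZS ZT : ℂ)
    (x : EuclideanSpace ℝ (Fin 3)) : Matrix (Fin 3) (Fin 3) ℂ :=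
  ((Z + ZM) * ((a : ℂ) / (‖x‖ : ℂ))) •
    ((Complex.exp (I * k * ((‖x‖ : ℝ) - a)) / (ZL + ZM)) •
        ((1 / ((k : ℂ) * ‖x‖) ^ 2 - I / ((k : ℂ) * ‖x‖)) • (1 : Matrix (Fin 3) (Fin 3) ℂ)
          + (1 + 3 * I / ((k : ℂ) * ‖x‖) - 3 / ((k : ℂ) * ‖x‖) ^ 2) • outerUnit x)
      + (ZS / ZT * Complex.exp (I * h * ((‖x‖ : ℝ) - a)) / (ZS + ZM)) •
        ((1 + I / ((h : ℂ) * ‖x‖) - 1 / ((h : ℂ) * ‖x‖) ^ 2) • (1 : Matrix (Fin 3) (Fin 3) ℂ)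
          - (1 + 3 * I / ((h : ℂ) * ‖x‖) - 3 / ((h : ℂ) * ‖x‖) ^ 2) • outerUnit x))

/-- The free-space elastodynamic Green's tensor `G⁰(r)`, Eq. (92) of the paper. -/
noncomputable def Green0 (k h mu : ℝ) (x : EuclideanSpace ℝ (Fin 3)) :
    Matrix (Fin 3) (Fin 3) ℂ :=
  let f : EuclideanSpace ℝ (Fin 3) → ℂ := fun y =>
    (Complex.exp (I * h * (‖y‖ : ℝ)) - Complex.exp (I * k * (‖y‖ : ℝ)))
      / ((h : ℂ) ^ 2 * (‖y‖ : ℂ))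
  let Hess : Matrix (Fin 3) (Fin 3) ℂ := Matrix.of fun i j =>
    fderiv ℝ (fun y => fderiv ℝ f y (EuclideanSpace.single j 1)) x (EuclideanSpace.single i 1)
  ((1 : ℂ) / (4 * Real.pi * mu)) •
    ((Complex.exp (I * h * (‖x‖ : ℝ)) / (‖x‖ : ℂ)) • (1 : Matrix (Fin 3) (Fin 3) ℂ) + Hess)


/-- Radial profile. -/
noncomputable def fax_g (k h : ℝ) (t : ℝ) : ℂ :=
  (Complex.exp (I * h * (t : ℝ)) - Complex.exp (I * k * (t : ℝ))) / ((h : ℂ) ^ 2 * (t : ℂ))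

noncomputable def fax_g1 (k h : ℝ) (t : ℝ) : ℂ :=
  ((I * h * Complex.exp (I * h * (t : ℝ)) - I * k * Complex.exp (I * k * (t : ℝ))) / (t : ℂ)
    - (Complex.exp (I * h * (t : ℝ)) - Complex.exp (I * k * (t : ℝ))) / (t : ℂ) ^ 2) / (h : ℂ) ^ 2

noncomputable def fax_g2 (k h : ℝ) (t : ℝ) : ℂ :=
  ((-(h : ℂ) ^ 2 * Complex.exp (I * h * (t : ℝ)) + (k : ℂ) ^ 2 * Complex.exp (I * k * (t : ℝ))) / (t : ℂ)
    - 2 * (I * h * Complex.exp (I * h * (t : ℝ)) - I * k * Complex.exp (I * k * (t : ℝ))) / (t : ℂ) ^ 2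
    + 2 * (Complex.exp (I * h * (t : ℝ)) - Complex.exp (I * k * (t : ℝ))) / (t : ℂ) ^ 3) / (h : ℂ) ^ 2

lemma fax_ofReal (t : ℝ) : HasDerivAt (fun t : ℝ => (t : ℂ)) 1 t :=
  Complex.ofRealCLM.hasDerivAt (x := t)

lemma fax_exp (c : ℂ) (t : ℝ) :
    HasDerivAt (fun t : ℝ => Complex.exp (c * (t : ℂ))) (c * Complex.exp (c * (t : ℂ))) t := by
  have := ((fax_ofReal t).const_mul c).cexp
  convert this using 1
  ring

lemma fax_g_deriv (k h t : ℝ) (hh : h ≠ 0) (ht : t ≠ 0) :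
    HasDerivAt (fax_g k h) (fax_g1 k h t) t := by
  have ht' : (t : ℂ) ≠ 0 := by exact_mod_cast ht
  have hh' : (h : ℂ) ≠ 0 := by exact_mod_cast hh
  have := ((fax_exp (I * h) t).sub (fax_exp (I * k) t)).div
    ((fax_ofReal t).const_mul ((h : ℂ) ^ 2)) (mul_ne_zero (pow_ne_zero 2 hh') ht')
  refine HasDerivAt.congr_deriv (f := fax_g k h) this ?_
  unfold fax_g1
  simp only [Pi.sub_apply]
  field_simp

lemma fax_g1_deriv (k h t : ℝ) (hh : h ≠ 0) (ht : t ≠ 0) :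
    HasDerivAt (fax_g1 k h) (fax_g2 k h t) t := by
  have ht' : (t : ℂ) ≠ 0 := by exact_mod_cast ht
  have hh' : (h : ℂ) ≠ 0 := by exact_mod_cast hh
  have e1 := fax_exp (I * h) t
  have e2 := fax_exp (I * k) t
  have := ((((e1.const_mul (I * h)).sub (e2.const_mul (I * k))).div (fax_ofReal t) ht').sub
    ((e1.sub e2).div ((fax_ofReal t).pow 2) (pow_ne_zero 2 ht'))).div_const ((h : ℂ) ^ 2)
  refine HasDerivAt.congr_deriv (f := fax_g1 k h) this ?_
  unfold fax_g2
  simp only [Pi.sub_apply, Pi.pow_apply]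
  field_simp
  ring_nf
  simp only [I_sq]
  ring

lemma fax_contDiff (k h : ℝ) (hh : h ≠ 0) (x : EuclideanSpace ℝ (Fin 3)) (hx : x ≠ 0) :
    ContDiffAt ℝ 2 (fun y : EuclideanSpace ℝ (Fin 3) => fax_g k h ‖y‖) x := by
  have hn : ContDiffAt ℝ 2 (fun y : EuclideanSpace ℝ (Fin 3) => ((‖y‖ : ℝ) : ℂ)) x :=
    Complex.ofRealCLM.contDiff.contDiffAt.comp x (contDiffAt_norm ℝ hx)
  have hx' : ((‖x‖ : ℝ) : ℂ) ≠ 0 := by exact_mod_cast norm_ne_zero_iff.mpr hx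
  have hh' : (h : ℂ) ≠ 0 := by exact_mod_cast hh
  have hE : ∀ c : ℂ, ContDiffAt ℝ 2
      (fun y : EuclideanSpace ℝ (Fin 3) => Complex.exp (c * ((‖y‖ : ℝ) : ℂ))) x :=
    fun c => (contDiffAt_const.mul hn).cexp
  have hD : ContDiffAt ℝ 2
      (fun y : EuclideanSpace ℝ (Fin 3) => ((h : ℂ) ^ 2 * ((‖y‖ : ℝ) : ℂ))⁻¹) x :=
    (contDiffAt_const.mul hn).inv (mul_ne_zero (pow_ne_zero 2 hh') hx')
  unfold fax_g
  simp only [div_eq_mul_inv]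
  exact ((hE _).sub (hE _)).mul hD

lemma fax_hess_aux (f : EuclideanSpace ℝ (Fin 3) → ℂ) (g g1 : ℝ → ℂ) (g2 : ℂ)
    (n : EuclideanSpace ℝ (Fin 3)) (r : ℝ) (hr : 0 < r)
    (hcd : ∀ t : ℝ, 0 < t → ContDiffAt ℝ 2 f (t • n))
    (hfg : ∀ t : ℝ, 0 < t → f (t • n) = g t)
    (hg1 : ∀ t : ℝ, 0 < t → HasDerivAt g (g1 t) t)
    (hg2 : HasDerivAt g1 g2 r) :
    fderiv ℝ (fderiv ℝ f) (r • n) n n = g2 := by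
  have hline : ∀ t : ℝ, HasDerivAt (fun t : ℝ => t • n) n t := fun t => by
    simpa using (hasDerivAt_id t).smul_const n
  have h1 : ∀ t : ℝ, 0 < t → fderiv ℝ f (t • n) n = g1 t := fun t ht => by
    have hd := ((hcd t ht).differentiableAt (by norm_num)).hasFDerivAt.comp_hasDerivAt t (hline t)
    have hg : HasDerivAt (f ∘ fun t : ℝ => t • n) (g1 t) t := by
      refine (hg1 t ht).congr_of_eventuallyEq ?_
      filter_upwards [lt_mem_nhds ht] with s hs
      exact hfg s hs
    exact hd.unique hg
  have hd2 : DifferentiableAt ℝ (fderiv ℝ f) (r • n) :=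
    ((hcd r hr).fderiv_right (m := 1) (by norm_num)).differentiableAt (by norm_num)
  have hc : HasDerivAt (fun t : ℝ => fderiv ℝ f (t • n)) (fderiv ℝ (fderiv ℝ f) (r • n) n) r :=
    hd2.hasFDerivAt.comp_hasDerivAt r (hline r)
  have hd : HasDerivAt (fun t : ℝ => fderiv ℝ f (t • n) n)
      (fderiv ℝ (fderiv ℝ f) (r • n) n n) r := by
    have := ((ContinuousLinearMap.apply ℝ ℂ n).hasFDerivAt
      (x := fderiv ℝ f (r • n))).comp_hasDerivAt r hc
    exact this
  have hg : HasDerivAt (fun t : ℝ => fderiv ℝ f (t • n) n) g2 r := by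
    refine hg2.congr_of_eventuallyEq ?_
    filter_upwards [lt_mem_nhds hr] with s hs
    exact h1 s hs
  exact hd.unique hg

lemma fax_hess (k h : ℝ) (hh : h ≠ 0) (n : EuclideanSpace ℝ (Fin 3)) (hn : ‖n‖ = 1)
    (r : ℝ) (hr : 0 < r) :
    fderiv ℝ (fderiv ℝ (fun y : EuclideanSpace ℝ (Fin 3) => fax_g k h ‖y‖)) (r • n) n n
      = fax_g2 k h r := by
  have hn0 : n ≠ 0 := by rintro rfl; simp at hn
  refine fax_hess_aux _ (fax_g k h) (fax_g1 k h) _ n r hr ?_ ?_ ?_ ?_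
  · exact fun t ht => fax_contDiff k h hh _ (smul_ne_zero ht.ne' hn0)
  · intro t ht
    rw [norm_smul, hn, mul_one, Real.norm_of_nonneg ht.le]
  · exact fun t ht => fax_g_deriv k h t hh ht.ne'
  · exact fax_g1_deriv k h r hh hr.ne'

lemma fax_n_sum (n : EuclideanSpace ℝ (Fin 3)) :
    n = ∑ i, n i • EuclideanSpace.single i (1 : ℝ) := by
  ext j
  fin_cases j <;> simp [Fin.sum_univ_three]

lemma fax_nn (n : EuclideanSpace ℝ (Fin 3)) (hn : ‖n‖ = 1) :
    ((n 0 : ℝ) : ℂ) ^ 2 + ((n 1 : ℝ) : ℂ) ^ 2 + ((n 2 : ℝ) : ℂ) ^ 2 = 1 := by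
  have := EuclideanSpace.norm_sq_eq n
  rw [hn, Fin.sum_univ_three] at this
  simp only [Real.norm_eq_abs, sq_abs] at this
  norm_cast
  linarith

lemma fax_green (k h mu : ℝ) (hh : h ≠ 0) (n : EuclideanSpace ℝ (Fin 3)) (hn : ‖n‖ = 1)
    (r : ℝ) (hr : 0 < r) :
    ((fun i => ((n i : ℝ) : ℂ)) ⬝ᵥ
            (Green0 k h mu (r • n)) *ᵥ (fun i => ((n i : ℝ) : ℂ)))
    = ((1 : ℂ) / (4 * Real.pi * mu)) * (Complex.exp (I * h * r) / r + fax_g2 k h r) := by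
  have hn0 : n ≠ 0 := by rintro rfl; simp at hn
  have hnt : ‖r • n‖ = r := by
    rw [norm_smul, hn, mul_one, Real.norm_of_nonneg hr.le]
  have hcd := fax_contDiff k h hh _ (smul_ne_zero hr.ne' hn0)
  have hd2 : DifferentiableAt ℝ
      (fderiv ℝ (fun y : EuclideanSpace ℝ (Fin 3) => fax_g k h ‖y‖)) (r • n) :=
    (hcd.fderiv_right (m := 1) (by norm_num)).differentiableAt (by norm_num)
  have hH : ∀ i j : Fin 3, fderiv ℝ (fun y => fderiv ℝ
      (fun y : EuclideanSpace ℝ (Fin 3) => fax_g k h ‖y‖) y (EuclideanSpace.single j 1)) (r • n)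
      (EuclideanSpace.single i 1) =
      fderiv ℝ (fderiv ℝ (fun y : EuclideanSpace ℝ (Fin 3) => fax_g k h ‖y‖)) (r • n)
        (EuclideanSpace.single i 1) (EuclideanSpace.single j 1) := by
    intro i j
    rw [fderiv_clm_apply hd2 (differentiableAt_const _)]
    simp
  have hs := fax_hess k h hh n hn r hr
  have hnn := fax_nn n hn
  have hG : Green0 k h mu (r • n) = ((1 : ℂ) / (4 * Real.pi * mu)) •
    ((Complex.exp (I * h * r) / (r : ℂ)) • (1 : Matrix (Fin 3) (Fin 3) ℂ) + Matrix.of fun i j =>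
      fderiv ℝ (fderiv ℝ (fun y : EuclideanSpace ℝ (Fin 3) => fax_g k h ‖y‖)) (r • n)
        (EuclideanSpace.single i 1) (EuclideanSpace.single j 1)) := by
    simp only [← hH]
    unfold Green0
    simp only [hnt]
    rfl
  rw [hG, ← hs]
  generalize fderiv ℝ (fderiv ℝ (fun y : EuclideanSpace ℝ (Fin 3) => fax_g k h ‖y‖)) (r • n) = D
  have hD : D n n = ∑ i, ∑ j, ((n i : ℝ) : ℂ) * ((n j : ℝ) : ℂ) *
      D (EuclideanSpace.single i 1) (EuclideanSpace.single j 1) := by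
    conv_lhs => rw [fax_n_sum n]
    simp only [map_sum, map_smul, _root_.sum_apply, _root_.smul_apply,
      Complex.real_smul, Finset.mul_sum, Finset.smul_sum]
    try rw [Finset.sum_comm]
    refine Finset.sum_congr rfl fun i _ => Finset.sum_congr rfl fun j _ => ?_
    ring
  rw [hD]
  simp only [dotProduct, mulVec, Fin.sum_univ_three, Matrix.smul_apply, Matrix.add_apply,
    Matrix.of_apply, Matrix.one_apply, smul_eq_mul]
  simp
  linear_combination ((Real.pi : ℂ)⁻¹ * (mu : ℂ)⁻¹ * 4⁻¹ * Complex.exp (I * h * r) / r) * hnn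

lemma fax_U (a k h : ℝ) (Z ZM ZL ZS ZT c : ℂ) (n : EuclideanSpace ℝ (Fin 3)) (hn : ‖n‖ = 1)
    (r : ℝ) (hr : 0 < r) :
    ((fun i => ((n i : ℝ) : ℂ)) ⬝ᵥ
            (c • Udisp a k h Z ZM ZL ZS ZT (r • n)) *ᵥ (fun i => ((n i : ℝ) : ℂ)))
    = c * ((Z + ZM) * ((a : ℂ) / r) *
      (Complex.exp (I * k * (r - a)) / (ZL + ZM) *
        (1 + 2 * I / ((k : ℂ) * r) - 2 / ((k : ℂ) * r) ^ 2)
      + (ZS / ZT * Complex.exp (I * h * (r - a)) / (ZS + ZM)) *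
        (-2 * I / ((h : ℂ) * r) + 2 / ((h : ℂ) * r) ^ 2))) := by
  have hnt : ‖r • n‖ = r := by
    rw [norm_smul, hn, mul_one, Real.norm_of_nonneg hr.le]
  have hnn := fax_nn n hn
  have hO : outerUnit (r • n) = Matrix.of fun i j => ((n i : ℝ) : ℂ) * ((n j : ℝ) : ℂ) := by
    unfold outerUnit
    ext i j
    simp only [hnt, Matrix.of_apply, PiLp.smul_apply, smul_eq_mul]
    rw [mul_div_cancel_left₀ _ hr.ne', mul_div_cancel_left₀ _ hr.ne']
    push_cast; rfl
  have key : ∀ A B : ℂ, ((fun i => ((n i : ℝ) : ℂ)) ⬝ᵥ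
      (A • (1 : Matrix (Fin 3) (Fin 3) ℂ) + B • outerUnit (r • n)) *ᵥ
        (fun i => ((n i : ℝ) : ℂ))) = A + B := by
    intro A B
    rw [hO]
    simp only [dotProduct, mulVec, Fin.sum_univ_three, Matrix.smul_apply, Matrix.add_apply,
      Matrix.of_apply, Matrix.one_apply, smul_eq_mul]
    simp
    linear_combination (A + B * ((n 0 : ℂ) ^ 2 + (n 1 : ℂ) ^ 2 + (n 2 : ℂ) ^ 2 + 1)) * hnn
  unfold Udisp
  rw [hnt]
  rw [sub_eq_add_neg (_ • (1 : Matrix (Fin 3) (Fin 3) ℂ)), ← neg_smul]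
  have lin : ∀ (v : Fin 3 → ℂ) (s p q : ℂ) (M N : Matrix (Fin 3) (Fin 3) ℂ),
      v ⬝ᵥ (c • s • (p • M + q • N)) *ᵥ v = c * (s * (p * (v ⬝ᵥ M *ᵥ v) + q * (v ⬝ᵥ N *ᵥ v))) := by
    intro v s p q M N
    simp only [smul_mulVec, dotProduct_smul, add_mulVec, dotProduct_add, smul_eq_mul]
  rw [lin, key, key]
  ring

/-- Faxén force coefficient for longitudinal plane wave incidence (Eq. (+1) of the
paper): the far-field ratio of the radial-radial components of the force tensor
`Φ(r) = (Z_P/(Z+Z_P)) U(r)` and the free-space Green's tensor converges to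
`Λ = 4πa(λ+2μ) e^{−ika} (Z_P/(Z+Z_P)) (Z+Z_M)/(Z_L+Z_M)`. -/
theorem faxen_force_longitudinal (a ρ lam mu ω : ℝ)
    (ha : 0 < a) (hρ : 0 < ρ) (hmu : 0 < mu) (hlam : 0 < lam + 2 * mu) (hω : 0 < ω)
    (k h : ℝ)
    (hk : k = ω / Real.sqrt ((lam + 2 * mu) / ρ)) (hh : h = ω / Real.sqrt (mu / ρ))
    (ZM ZL ZT ZS Z ZP : ℂ)
    (hZM : ZM = I * ω * (4 / 3) * Real.pi * a ^ 3 * ρ)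
    (hZL : ZL = (I * ω)⁻¹ * (4 * Real.pi * a * (lam + 2 * mu)) * (1 - I * k * a))
    (hZT : ZT = (I * ω)⁻¹ * (4 * Real.pi * a * mu) * (1 - I * h * a))
    (hZT0 : ZT ≠ 0) (hLM : ZL + ZM ≠ 0) (hSM : ZS + ZM ≠ 0) (hZZP : Z + ZP ≠ 0)
    (n : EuclideanSpace ℝ (Fin 3)) (hn : ‖n‖ = 1) :
    Tendsto (fun r : ℝ =>
        ((fun i => ((n i : ℝ) : ℂ)) ⬝ᵥ
            ((ZP / (Z + ZP)) • Udisp a k h Z ZM ZL ZS ZT (r • n)) *ᵥ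
              (fun i => ((n i : ℝ) : ℂ))) /
        ((fun i => ((n i : ℝ) : ℂ)) ⬝ᵥ
            (Green0 k h mu (r • n)) *ᵥ (fun i => ((n i : ℝ) : ℂ))))
      atTop
      (𝓝 ((4 * Real.pi * a * (lam + 2 * mu) : ℝ) * Complex.exp (-(I * k * a))
            * (ZP / (Z + ZP)) * ((Z + ZM) / (ZL + ZM)))) := by
  have hk0 : 0 < k := by rw [hk]; positivity
  have hh0 : 0 < h := by rw [hh]; positivity
  have hkh : k ^ 2 * (lam + 2 * mu) = h ^ 2 * mu := by
    rw [hk, hh, div_pow, div_pow, Real.sq_sqrt (by positivity), Real.sq_sqrt (by positivity)]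
    field_simp
  have hkc : (k : ℂ) ≠ 0 := by exact_mod_cast hk0.ne'
  have hhc : (h : ℂ) ≠ 0 := by exact_mod_cast hh0.ne'
  have hmuc : (mu : ℂ) ≠ 0 := by exact_mod_cast hmu.ne'
  have hpi : (Real.pi : ℂ) ≠ 0 := by exact_mod_cast Real.pi_ne_zero
  have hkhc : (k : ℂ) ^ 2 * ((lam : ℂ) + 2 * mu) = (h : ℂ) ^ 2 * mu := by exact_mod_cast hkh
  have hlc : (lam : ℂ) + 2 * mu ≠ 0 := by exact_mod_cast hlam.ne'
  set c := ZP / (Z + ZP)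
  -- decaying quantities
  have hu : Tendsto (fun r : ℝ => ((r : ℂ))⁻¹) atTop (𝓝 0) := by
    have := (Complex.continuous_ofReal.tendsto 0).comp tendsto_inv_atTop_zero
    simpa [Function.comp_def] using this
  have hE : Tendsto (fun r : ℝ => Complex.exp (I * (h - k) * r) * ((r : ℂ))⁻¹) atTop (𝓝 0) := by
    rw [tendsto_zero_iff_norm_tendsto_zero] at hu ⊢
    refine hu.congr fun r => ?_
    have : I * ((h : ℂ) - k) * r = (((h - k) * r : ℝ) : ℂ) * I := by push_cast; ring
    rw [norm_mul, this, Complex.norm_exp_ofReal_mul_I, one_mul]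
  have tN : Tendsto (fun r : ℝ => c * ((Z + ZM) * a * (
      Complex.exp (-(I * k * a)) / (ZL + ZM) *
        (1 + 2 * I / k * (r : ℂ)⁻¹ - 2 / (k : ℂ) ^ 2 * ((r : ℂ)⁻¹ * (r : ℂ)⁻¹))
      + ZS / ZT * Complex.exp (-(I * h * a)) / (ZS + ZM) *
        (-2 * I / h * (Complex.exp (I * (h - k) * r) * ((r : ℂ))⁻¹)
          + 2 / (h : ℂ) ^ 2 * ((Complex.exp (I * (h - k) * r) * ((r : ℂ))⁻¹) * (r : ℂ)⁻¹)))))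
      atTop (𝓝 (c * ((Z + ZM) * a * (
      Complex.exp (-(I * k * a)) / (ZL + ZM) *
        (1 + 2 * I / k * 0 - 2 / (k : ℂ) ^ 2 * (0 * 0))
      + ZS / ZT * Complex.exp (-(I * h * a)) / (ZS + ZM) *
        (-2 * I / h * 0 + 2 / (h : ℂ) ^ 2 * (0 * 0)))))) :=
    ((((((hu.const_mul _).const_add _).sub ((hu.mul hu).const_mul _)).const_mul _).add
      (((hE.const_mul _).add ((hE.mul hu).const_mul _)).const_mul _)).const_mul _).const_mul _
  have tD : Tendsto (fun r : ℝ => (1 : ℂ) / (4 * Real.pi * mu) * (((k : ℂ) ^ 2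
      + -2 * I * h * (Complex.exp (I * (h - k) * r) * ((r : ℂ))⁻¹) + 2 * I * k * (r : ℂ)⁻¹
      + 2 * ((Complex.exp (I * (h - k) * r) * ((r : ℂ))⁻¹) * (r : ℂ)⁻¹)
      - 2 * ((r : ℂ)⁻¹ * (r : ℂ)⁻¹)) / (h : ℂ) ^ 2)) atTop
      (𝓝 ((1 : ℂ) / (4 * Real.pi * mu) * (((k : ℂ) ^ 2
      + -2 * I * h * 0 + 2 * I * k * 0 + 2 * (0 * 0) - 2 * (0 * 0)) / (h : ℂ) ^ 2))) :=
    ((((((hE.const_mul _).const_add _).add (hu.const_mul _)).add ((hE.mul hu).const_mul _)).sub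
      ((hu.mul hu).const_mul _)).div_const _).const_mul _
  have hq := tN.div tD (by
    simp only [mul_zero, add_zero, sub_zero]
    have := pow_ne_zero 2 hkc
    have := pow_ne_zero 2 hhc
    exact mul_ne_zero (one_div_ne_zero (mul_ne_zero (mul_ne_zero (by norm_num) hpi) hmuc)) (div_ne_zero ‹_› ‹_›))
  have hlim : ∀ {A B : ℂ} {f g : ℝ → ℂ}, Tendsto f atTop (𝓝 A) → A = B → f =ᶠ[atTop] g →
      Tendsto g atTop (𝓝 B) := fun hf hAB hfg => hAB ▸ hf.congr' hfg
  refine hlim hq ?_ ?_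
  · push_cast
    simp only [mul_zero, add_zero, sub_zero]
    rw [show (k : ℂ) ^ 2 = h ^ 2 * mu / (lam + 2 * mu) by rw [eq_div_iff hlc, hkhc]]
    field_simp
  · filter_upwards [eventually_gt_atTop 0] with r hr
    have hrc : (r : ℂ) ≠ 0 := by exact_mod_cast hr.ne'
    rw [fax_green k h mu hh0.ne' n hn r hr, fax_U a k h Z ZM ZL ZS ZT c n hn r hr]
    have e0 : Complex.exp (I * k * r) ≠ 0 := Complex.exp_ne_zero _
    have e1 : Complex.exp (I * k * (r - a)) = Complex.exp (I * k * r) * Complex.exp (-(I * k * a)) := by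
      rw [← Complex.exp_add]; ring_nf
    have e3 : Complex.exp (I * h * r) = Complex.exp (I * k * r) * Complex.exp (I * (h - k) * r) := by
      rw [← Complex.exp_add]; ring_nf
    have e2 : Complex.exp (I * h * (r - a)) =
        Complex.exp (I * k * r) * Complex.exp (I * (h - k) * r) * Complex.exp (-(I * h * a)) := by
      rw [← e3, ← Complex.exp_add]; ring_nf
    have hw : Complex.exp (I * k * r) / r ≠ 0 := div_ne_zero e0 hrc
    rw [Pi.div_apply, ← mul_div_mul_left _ _ hw]
    unfold fax_g2
    rw [e1, e2, e3]
    generalize Complex.exp (I * k * r) = X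
    generalize Complex.exp (I * (h - k) * r) = Y
    congr 1
    · field_simp
    · field_simp
      ring
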